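/- arXiv:2310.16118 — 2 statements merged into one kernel-verified Lean document; each statement's English description precedes it below -/
import Mathlib

section
/- Let p be an odd prime and let G = D_{2p} be the dihedral group of order 2p. For every odd natural number n, the group cohomology H^n(G; ℤ) with coefficients in the trivial representation ℤ is the zero group. -/
open CategoryTheory

universe u

section Transfer

variable {k G : Type u} [CommRing k] [Group G] (S : Subgroup G) (A : Rep.{u} k G)

/-- The function on right cosets of `S` induced by `g ↦ g⁻¹ • f g`, for `f` in the coinduction
from `S` of the restriction of `A`. -/
noncomputable def Rep.coindResCosetFun (f : Rep.coind S.subtype (Rep.res S.subtype A)) :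
    Quotient (QuotientGroup.rightRel S) → A :=
  Quotient.lift (fun g : G => A.ρ g⁻¹ (f.1 g)) fun a b hab => by
    have hs : b * a⁻¹ ∈ S := QuotientGroup.rightRel_apply.1 hab
    have h : f.1 b = A.ρ (b * a⁻¹) (f.1 a) := by
      simpa using f.2 ⟨b * a⁻¹, hs⟩ a
    simp [h, ← Module.End.mul_apply, ← map_mul]

/-- The permutation of the right cosets of `S` given by right multiplication by `g`. -/
def Subgroup.rightCosetMulRight (g : G) :
    Quotient (QuotientGroup.rightRel S) ≃ Quotient (QuotientGroup.rightRel S) :=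
  Quotient.congr (Equiv.mulRight g) fun a b => by
    change QuotientGroup.rightRel S a b ↔ QuotientGroup.rightRel S (a * g) (b * g)
    simp [QuotientGroup.rightRel_apply, mul_assoc]

/-- The trace morphism `Coind_S^G(Res(A)) ⟶ A`, `f ↦ ∑ g⁻¹ • f g`, summing over the right cosets
of a subgroup `S` of finite index. -/
noncomputable def Rep.coindResTrace [Fintype (Quotient (QuotientGroup.rightRel S))] :
    Rep.coind S.subtype (Rep.res S.subtype A) ⟶ A :=
  Rep.ofHom (σ := A.ρ)
    { toFun := fun f => ∑ c, Rep.coindResCosetFun S A f c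
      map_add' := fun f₁ f₂ => by
        rw [← Finset.sum_add_distrib]
        refine Finset.sum_congr rfl fun c _ => ?_
        induction c using Quotient.inductionOn with | h a => exact map_add (A.ρ a⁻¹) _ _
      map_smul' := fun r f => by
        rw [Finset.smul_sum]
        refine Finset.sum_congr rfl fun c _ => ?_
        induction c using Quotient.inductionOn with | h a => exact map_smul (A.ρ a⁻¹) _ _
      isIntertwining' := fun g => by
        ext f
        change ∑ c, Rep.coindResCosetFun S A _ c = A.ρ g (∑ c, Rep.coindResCosetFun S A f c)
        rw [map_sum, ← Equiv.sum_comp (S.rightCosetMulRight g)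
          fun c => A.ρ g (Rep.coindResCosetFun S A f c)]
        refine Finset.sum_congr rfl fun c _ => ?_
        induction c using Quotient.inductionOn with
        | h a =>
          change A.ρ a⁻¹ (f.1 (a * g)) = A.ρ g (A.ρ (a * g)⁻¹ (f.1 (a * g)))
          simp [← Module.End.mul_apply, ← map_mul] }

/-- The unit `A ⟶ Coind_S^G(Res(A))` followed by the trace is multiplication by the index. -/
lemma Rep.resCoindToHom_comp_coindResTrace [Fintype (Quotient (QuotientGroup.rightRel S))] :
    Rep.resCoindToHom S.subtype A (Rep.res S.subtype A) (𝟙 _) ≫ Rep.coindResTrace S A =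
      S.index • 𝟙 A := by
  ext x
  trans ∑ _c : Quotient (QuotientGroup.rightRel S), x
  · refine Finset.sum_congr rfl fun c _ => ?_
    induction c using Quotient.inductionOn with
    | h a =>
      change A.ρ a⁻¹ (A.ρ a x) = x
      simp
  · rw [Finset.sum_const, Finset.card_univ, Subgroup.index, ← Nat.card_eq_fintype_card,
      Nat.card_congr (QuotientGroup.quotientRightRelEquivQuotientLeftRel S)]
    rfl

instance groupCohomology.functor_additive (n : ℕ) : (groupCohomology.functor k G n).Additive :=
  inferInstanceAs (groupCohomology.cochainsFunctor k G ⋙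
    HomologicalComplex.homologyFunctor (ModuleCat k) _ n).Additive

/-- If the cohomology of a finite index subgroup `S` with coefficients in `A` vanishes in degree
`n`, then the index of `S` annihilates `Hⁿ(G, A)`. -/
lemma groupCohomology.index_nsmul_eq_zero [S.FiniteIndex] (n : ℕ)
    [Subsingleton (groupCohomology (Rep.res S.subtype A) n)] (x : groupCohomology A n) :
    S.index • x = 0 := by
  have := S.fintypeQuotientOfFiniteIndex
  have := Fintype.ofEquiv (G ⧸ S) (QuotientGroup.quotientRightRelEquivQuotientLeftRel S).symm
  have : Subsingleton (groupCohomology (Rep.coind S.subtype (Rep.res S.subtype A)) n) :=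
    (groupCohomology.coindIso (Rep.res S.subtype A) n).toLinearEquiv.injective.subsingleton
  have hz : Limits.IsZero ((groupCohomology.functor k G n).obj
      (Rep.coind S.subtype (Rep.res S.subtype A))) :=
    ModuleCat.isZero_of_subsingleton (groupCohomology _ n)
  have h := congrArg (groupCohomology.functor k G n).map
    (Rep.resCoindToHom_comp_coindResTrace S A)
  rw [Functor.map_comp, hz.eq_zero_of_tgt ((groupCohomology.functor k G n).map
      (Rep.resCoindToHom _ _ _ _)), Limits.zero_comp,
    Functor.map_nsmul, CategoryTheory.Functor.map_id] at h
  exact congrArg (fun φ => ModuleCat.Hom.hom φ x) h.symm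

end Transfer

/-- The cohomology of a finite cyclic group with trivial coefficients in a torsion-free module
vanishes in odd degrees. -/
lemma groupCohomology.subsingleton_trivial_of_isCyclic_of_odd {k G : Type u} [CommRing k] [Group G]
    [Finite G] [IsCyclic G] (V : Type u) [AddCommGroup V] [Module k V]
    [IsAddTorsionFree V] (n : ℕ) (hn : Odd n) :
    Subsingleton (groupCohomology (Rep.trivial k G V) n) := by
  let _ : CommGroup G := IsCyclic.commGroup
  have := Fintype.ofFinite G
  obtain ⟨g, hg⟩ := IsCyclic.exists_generator (α := G)
  have e := Rep.FiniteCyclicGroup.groupCohomologyIsoOdd (Rep.trivial k G V) g hg n hn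
  have : Mono (Rep.FiniteCyclicGroup.subCompNormHom (Rep.trivial k G V) g).g := by
    rw [ModuleCat.mono_iff_injective]
    intro x y hxy
    have hN (z : V) : (Rep.trivial k G V).norm.hom z = Fintype.card G • z := by
      simp [Rep.norm, Representation.norm]
    have h : Fintype.card G • (x : V) = Fintype.card G • y := (hN x).symm.trans (hxy.trans (hN y))
    exact nsmul_right_injective Fintype.card_ne_zero h
  have hf : (Rep.FiniteCyclicGroup.subCompNormHom (Rep.trivial k G V) g).f = 0 := by
    ext x
    exact sub_self (x : V)
  have h := (ShortComplex.exact_iff_isZero_homology _).1 ((ShortComplex.exact_iff_mono _ hf).2 this)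
  exact ModuleCat.subsingleton_of_isZero (h.of_iso e)

/-- For `p` an odd prime and `G = D_{2p}` the dihedral group of order `2p`, the group
cohomology `H^n(G; ℤ)` with trivial coefficients vanishes in every odd degree `n`. -/
theorem dihedral_trivial_cohomology_odd_degree_zero (p : ℕ) (hp : p.Prime) (hodd : Odd p)
    (n : ℕ) (hn : Odd n) :
    Subsingleton (groupCohomology (Rep.trivial ℤ (DihedralGroup p) ℤ) n) := by
  have : NeZero p := ⟨hp.ne_zero⟩
  have key (g : DihedralGroup p) (x : groupCohomology (Rep.trivial ℤ (DihedralGroup p) ℤ) n) :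
      (Subgroup.zpowers g).index • x = 0 := by
    have : Subsingleton (groupCohomology (Rep.res (Subgroup.zpowers g).subtype
        (Rep.trivial ℤ (DihedralGroup p) ℤ)) n) :=
      groupCohomology.subsingleton_trivial_of_isCyclic_of_odd (k := ℤ)
        (G := Subgroup.zpowers g) ℤ n hn
    exact groupCohomology.index_nsmul_eq_zero _ _ n x
  have index_mul (g : DihedralGroup p) : orderOf g * (Subgroup.zpowers g).index = 2 * p := by
    rw [← Nat.card_zpowers, Subgroup.card_mul_index, DihedralGroup.nat_card]
  have hr := index_mul (.r 1)
  have hs := index_mul (.sr 0)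
  rw [DihedralGroup.orderOf_r_one, mul_comm] at hr
  rw [DihedralGroup.orderOf_sr] at hs
  have hr' := Nat.eq_of_mul_eq_mul_right hp.pos hr
  have hs' := Nat.eq_of_mul_eq_mul_left two_pos hs
  refine subsingleton_of_forall_eq 0 fun x => ?_
  have h2 := key (.r 1) x
  have hpx := key (.sr 0) x
  rw [hr'] at h2
  rw [hs'] at hpx
  obtain ⟨m, rfl⟩ := hodd
  rwa [add_nsmul, mul_nsmul, h2, smul_zero, zero_add, one_nsmul] at hpx
end

section
/- Let p be an odd prime and let G = D_{2p} be the dihedral group of order 2p. For every natural number n with n ≡ 2 (mod 4), the group cohomology H^n(G; ℤ) with coefficients in the trivial representation ℤ is isomorphic to ℤ/2. -/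
open CategoryTheory Limits

namespace groupCohomology

universe u

/-- If the identity of `A` is the norm of some linear endomorphism of `A`, then `A` is a direct
summand of a representation coinduced from the trivial subgroup, and hence has no cohomology in
positive degrees. -/
theorem isZero_succ_of_sum_conj_eq {k G : Type u} [CommRing k] [Group G] [Fintype G]
    (A : Rep.{u} k G) (f : A →ₗ[k] A) (hf : ∀ a, ∑ g, A.ρ g (f (A.ρ g⁻¹ a)) = a) (n : ℕ) :
    IsZero (groupCohomology A (n + 1)) := by
  let B : Rep k (⊥ : Subgroup G) := Rep.res (⊥ : Subgroup G).subtype A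
  let C : Rep k G := Rep.coind (⊥ : Subgroup G).subtype B
  let i : A ⟶ C := Rep.ofHom
    { toFun a := ⟨fun h => A.ρ h a, fun s h => by simp [B]⟩
      map_add' a b := by ext; simp
      map_smul' r a := by ext; simp
      isIntertwining' g := by
        ext a : 1
        refine Subtype.ext (funext fun h => ?_)
        change A.ρ h (A.ρ g a) = A.ρ (h * g) a
        simp }
  let r : C ⟶ A := Rep.ofHom (ρ := C.ρ)
    { toFun c := ∑ h : G, A.ρ h⁻¹ (f (c.1 h))
      map_add' a b := by
        rw [← Finset.sum_add_distrib]
        refine Finset.sum_congr rfl fun h _ => ?_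
        rw [← map_add, ← map_add]
        rfl
      map_smul' r a := by
        rw [RingHom.id_apply, Finset.smul_sum]
        refine Finset.sum_congr rfl fun h _ => ?_
        rw [← map_smul, ← map_smul]
        rfl
      isIntertwining' g := by
        ext c
        change ∑ h : G, A.ρ h⁻¹ (f (c.1 (h * g))) = A.ρ g (∑ h : G, A.ρ h⁻¹ (f (c.1 h)))
        rw [map_sum]
        refine Fintype.sum_equiv (Equiv.mulRight g) _ _ fun h => ?_
        simp }
  have hir : i ≫ r = 𝟙 A := by
    ext a
    have := hf a
    rw [← Equiv.sum_comp (Equiv.inv G)] at this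
    simpa [i, r] using this
  have hC : IsZero (groupCohomology C (n + 1)) :=
    (isZero_groupCohomology_succ_of_subsingleton B n).of_iso (coindIso B (n + 1))
  rw [IsZero.iff_id_eq_zero, ← map_id (B := A), ← hir, map_id_comp,
    hC.eq_of_tgt (map (MonoidHom.id G) i (n + 1)) 0, zero_comp]

variable {k G : Type u} [CommRing k] [Group G]

theorem isZero_X₁_iff {X : ShortComplex (Rep.{u} k G)} (hX : X.ShortExact) (n : ℕ)
    (h : ∀ n, IsZero (groupCohomology X.X₂ (n + 1))) :
    IsZero (groupCohomology X.X₁ (n + 2)) ↔ IsZero (groupCohomology X.X₃ (n + 1)) :=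
  have := isIso_δ_of_isZero hX (n + 1) (h n) (h (n + 1))
  (asIso (δ hX (n + 1) (n + 2) rfl)).isZero_iff.symm

/-- A short exact sequence of representations from elementwise data. -/
theorem shortExact_of_exact {A B C : Rep.{u} k G} (f : A ⟶ B) (g : B ⟶ C)
    (hf : Function.Injective f.hom) (hg : Function.Surjective g.hom)
    (hfg : Function.Exact f.hom g.hom) :
    (ShortComplex.mk f g (by ext x; exact hfg.apply_apply_eq_zero x)).ShortExact where
  exact := by
    rw [← ShortComplex.exact_map_iff_of_faithful _ (forget₂ (Rep k G) (ModuleCat k)),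
      ShortComplex.ShortExact.moduleCat_exact_iff_function_exact]
    exact hfg
  mono_f := (Rep.mono_iff_injective f).2 hf
  epi_g := (Rep.epi_iff_surjective g).2 hg

theorem δ_zero_apply_eq_zero_iff {X : ShortComplex (Rep.{u} k G)} (hX : X.ShortExact)
    (x : groupCohomology X.X₃ 0) :
    δ hX 0 1 rfl x = 0 ↔ ∃ y ∈ X.X₂.ρ.invariants, X.g.hom y = ((H0Iso X.X₃).hom x).1 := by
  have key := (ShortComplex.ShortExact.moduleCat_exact_iff_function_exact _).1
    (mapShortComplex₃_exact hX (i := 0) rfl) x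
  refine key.trans ⟨?_, ?_⟩
  · rintro ⟨y, rfl⟩
    refine ⟨((H0Iso X.X₂).hom y).1, ((H0Iso X.X₂).hom y).2, ?_⟩
    have := ConcreteCategory.congr_hom (map_id_comp_H0Iso_hom X.g) y
    exact congrArg Subtype.val this.symm
  · rintro ⟨y, hy, hyx⟩
    refine ⟨(H0Iso X.X₂).inv ⟨y, hy⟩, ?_⟩
    apply (H0Iso X.X₃).toLinearEquiv.injective
    have := ConcreteCategory.congr_hom (map_id_comp_H0Iso_hom X.g) ((H0Iso X.X₂).inv ⟨y, hy⟩)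
    refine this.trans (Subtype.ext ?_)
    refine Eq.trans ?_ hyx
    change X.g.hom ((H0Iso X.X₂).hom ((H0Iso X.X₂).inv ⟨y, hy⟩)).1 = _
    rw [Iso.inv_hom_id_apply]

end groupCohomology

namespace Rep

variable {G : Type} [Group G]

/-- The abelian group `M` on which `G` acts through the sign character `χ`. -/
noncomputable abbrev twist (χ : G →* ℤˣ) (M : Type) [AddCommGroup M] : Rep ℤ G :=
  Rep.of
    { toFun g := (χ g : ℤ) • (LinearMap.id : M →ₗ[ℤ] M)
      map_one' := by ext; simp
      map_mul' g h := by ext; simp [mul_smul] }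

/-- The functions `S → M` on a permutation representation `S`, twisted by the sign
character `χ`. -/
noncomputable abbrev twistedFun {S : Type} (α : G →* Equiv.Perm S) (χ : G →* ℤˣ) (M : Type)
    [AddCommGroup M] : Rep ℤ G :=
  Rep.of
    { toFun g := (χ g : ℤ) • LinearMap.funLeft ℤ M (α g⁻¹)
      map_one' := by ext; simp
      map_mul' g h := by ext; simp [mul_smul] }

theorem twist_one (M : Type) [AddCommGroup M] : twist (1 : G →* ℤˣ) M = Rep.trivial ℤ G M := by
  have : (twist (1 : G →* ℤˣ) M).ρ = Representation.trivial ℤ G M := by ext; simp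
  exact congrArg Rep.of this

variable {S : Type} (α : G →* Equiv.Perm S) (χ : G →* ℤˣ) {M : Type} [AddCommGroup M]

@[simp]
theorem twist_ρ_apply (g : G) (m : M) : (twist χ M).ρ g m = (χ g : ℤ) • m := rfl

@[simp]
theorem twistedFun_ρ_apply (g : G) (φ : S → M) (s : S) :
    (twistedFun α χ M).ρ g φ s = (χ g : ℤ) • φ ((α g)⁻¹ s) := by
  rw [← map_inv]
  rfl

theorem intUnit_smul_smul (u : ℤˣ) (m : M) : (u : ℤ) • (u : ℤ) • m = m := by
  rw [← mul_smul, Int.units_coe_mul_self, one_smul]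

/-- If multiplication by the common order `N` of the fibres of the orbit map of `s₀` is bijective
on `M`, then the twisted functions on `S` with values in `M` are acyclic. -/
theorem isZero_groupCohomology_twistedFun [Fintype G] [DecidableEq S] (s₀ : S) (N : ℕ)
    (hN : ∀ s, (Finset.univ.filter fun g => α g s₀ = s).card = N)
    (hM : Function.Bijective fun m : M => N • m) (n : ℕ) :
    Limits.IsZero (groupCohomology (twistedFun α χ M) (n + 1)) := by
  let e : M ≃ₗ[ℤ] M := (AddEquiv.ofBijective (nsmulAddMonoidHom N) hM).toIntLinearEquiv
  refine groupCohomology.isZero_succ_of_sum_conj_eq _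
    (LinearMap.single ℤ (fun _ : S => M) s₀ ∘ₗ e.symm.toLinearMap ∘ₗ LinearMap.proj s₀) ?_ n
  intro φ
  funext s
  have key (g : G) : (twistedFun α χ M).ρ g (Pi.single s₀ (e.symm
      ((twistedFun α χ M).ρ g⁻¹ φ s₀))) s = if α g s₀ = s then e.symm (φ s) else 0 := by
    rw [twistedFun_ρ_apply, twistedFun_ρ_apply, Pi.single_apply, map_inv, map_inv, inv_inv]
    by_cases h : α g s₀ = s
    · subst h
      simp [intUnit_smul_smul]
    · rw [if_neg h, if_neg, smul_zero]
      rintro rfl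
      simp at h
  refine (Finset.sum_apply _ _ _).trans ((Finset.sum_congr rfl fun g _ => key g).trans ?_)
  rw [← Finset.sum_filter, Finset.sum_const, hN]
  exact e.apply_symm_apply (φ s)

variable (ε : G →* ℤˣ)

/-- The action of `G` on `{1, -1}` through the sign character `ε`. -/
def signPerm : G →* Equiv.Perm ℤˣ := (MulAction.toPermHom ℤˣ ℤˣ).comp ε

@[simp]
theorem signPerm_apply (g : G) (u : ℤˣ) : signPerm ε g u = ε g * u := rfl

/-- The embedding of constant functions. -/
noncomputable def constHom (M : Type) [AddCommGroup M] : twist χ M ⟶ twistedFun α χ M :=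
  Rep.ofHom
    { toFun m _ := m
      map_add' _ _ := rfl
      map_smul' _ _ := rfl
      isIntertwining' _ := rfl }

/-- The difference of the two values of a function on `{1, -1}`. -/
noncomputable def signDiffHom (M : Type) [AddCommGroup M] :
    twistedFun (signPerm ε) χ M ⟶ twist (χ * ε) M :=
  Rep.ofHom
    { toFun φ := φ 1 - φ (-1)
      map_add' φ ψ := by simp only [Pi.add_apply]; abel
      map_smul' r φ := by simp [smul_sub]
      isIntertwining' g := by
        refine LinearMap.ext fun φ => ?_
        change (twistedFun (signPerm ε) χ M).ρ g φ 1 - (twistedFun (signPerm ε) χ M).ρ g φ (-1) =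
          (twist (χ * ε) M).ρ g (φ 1 - φ (-1))
        rw [twistedFun_ρ_apply, twistedFun_ρ_apply, twist_ρ_apply]
        rw [← map_inv, signPerm_apply, signPerm_apply, map_inv]
        rcases Int.units_eq_one_or (ε g) with h | h
        · simp [h, smul_sub]
        · simp only [h, MonoidHom.mul_apply, inv_neg, inv_one, mul_neg, mul_one, neg_neg,
            Units.val_neg, neg_smul, smul_sub]
          abel }

theorem shortExact_signDiff :
    (CategoryTheory.ShortComplex.mk (constHom (signPerm ε) χ M) (signDiffHom χ ε M)
      (by ext m; exact sub_self m)).ShortExact := by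
  refine groupCohomology.shortExact_of_exact _ _ (fun a b h => congrFun h 1) (fun m => ?_) ?_
  · exact ⟨Pi.single 1 m, by
      change Pi.single (M := fun _ : ℤˣ => M) 1 m 1 - Pi.single (M := fun _ : ℤˣ => M) 1 m (-1) = m
      simp⟩
  · intro φ
    refine ⟨fun h => ⟨φ 1, funext fun u => ?_⟩, ?_⟩
    · rcases Int.units_eq_one_or u with rfl | rfl
      · rfl
      · exact sub_eq_zero.1 h
    · rintro ⟨m, rfl⟩
      exact sub_self m

end Rep

namespace ZMod

variable {p : ℕ} [NeZero p] {M : Type*} [AddCommGroup M]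

theorem exists_sub_eq_of_sum_eq_zero (φ : ZMod p → M) (hφ : ∑ s, φ s = 0) :
    ∃ ψ : ZMod p → M, ∀ s, ψ (s + 1) - ψ s = φ s := by
  refine ⟨fun s => ∑ i ∈ Finset.range s.val, φ i, fun s => ?_⟩
  have hs : ((s.val : ℕ) : ZMod p) = s := ZMod.natCast_zmod_val s
  rcases (Nat.succ_le_of_lt s.val_lt).lt_or_eq with h | h
  · have : (s + 1).val = s.val + 1 := by
      conv_lhs => rw [← hs, ← Nat.cast_succ, ZMod.val_cast_of_lt h]
    simp only [this, Finset.sum_range_succ, hs]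
    abel
  · have h0 : s + 1 = 0 := by
      conv_lhs => rw [← hs, ← Nat.cast_succ, h, ZMod.natCast_self]
    have hsum : ∑ i ∈ Finset.range p, φ i = 0 := by
      rw [← hφ]
      refine Finset.sum_nbij' (fun i => (i : ZMod p)) ZMod.val ?_ ?_ ?_ ?_ ?_
      · simp
      · intro t _
        simpa using t.val_lt
      · intro i hi
        exact ZMod.val_cast_of_lt (Finset.mem_range.1 hi)
      · simp
      · simp
    rw [show Finset.range p = Finset.range (s.val + 1) from congrArg _ h.symm,
      Finset.sum_range_succ, hs] at hsum
    simp only [h0, ZMod.val_zero, Finset.range_zero, Finset.sum_empty, zero_sub]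
    exact neg_eq_of_add_eq_zero_right hsum

omit [NeZero p] in
theorem exists_two_mul_eq_one (hp : Odd p) : ∃ h : ZMod p, 2 * h = 1 := by
  obtain ⟨k, hk⟩ := hp
  refine ⟨k + 1, ?_⟩
  have : ((2 * k + 1 : ℕ) : ZMod p) = 0 := by rw [← hk, ZMod.natCast_self]
  push_cast at this
  linear_combination this

theorem exists_sub_eq_of_sum_eq_zero_of_odd (hp : Odd p) (φ : ZMod p → M) (hφ : ∑ s, φ s = 0) :
    ∃ ψ : ZMod p → M, ∀ s, ψ (s + 1) - ψ (s - 1) = φ s := by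
  obtain ⟨h, hh⟩ := exists_two_mul_eq_one hp
  let e : ZMod p ≃ ZMod p :=
    { toFun s := 2 * s + 1
      invFun s := (s - 1) * h
      left_inv s := by linear_combination s * hh
      right_inv s := by linear_combination (s - 1) * hh }
  obtain ⟨ψ, hψ⟩ := exists_sub_eq_of_sum_eq_zero (φ ∘ e) ((Equiv.sum_comp e φ).trans hφ)
  refine ⟨fun s => ψ (s * h), fun s => ?_⟩
  have h1 : (s + 1) * h = e.symm s + 1 := by
    change _ = (s - 1) * h + 1
    linear_combination hh
  have h2 : (s - 1) * h = e.symm s := rfl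
  simp only [h1, h2, hψ, Function.comp_apply, Equiv.apply_symm_apply]

theorem eq_const_of_forall_sub_eq_zero (hp : Odd p) (φ : ZMod p → M)
    (hφ : ∀ s, φ (s + 1) - φ (s - 1) = 0) (s : ZMod p) : φ s = φ 0 := by
  obtain ⟨h, hh⟩ := exists_two_mul_eq_one hp
  have key (n : ℕ) : φ (2 * n) = φ 0 := by
    induction n with
    | zero => simp
    | succ n ih =>
      rw [← ih, ← sub_eq_zero, ← hφ (2 * n + 1)]
      congr 2 <;> push_cast <;> ring
  rw [← key (h * s).val, ZMod.natCast_zmod_val, ← mul_assoc, hh, one_mul]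

end ZMod

namespace DihedralGroup

variable (p : ℕ)

/-- The character of `DihedralGroup p` sending rotations to `1` and reflections to `-1`. -/
def sign : DihedralGroup p →* ℤˣ :=
  MonoidHom.mk' (fun | r _ => 1 | sr _ => -1) (by rintro (i | i) (j | j) <;> simp)

@[simp] theorem sign_r (i : ZMod p) : sign p (r i) = 1 := rfl

@[simp] theorem sign_sr (i : ZMod p) : sign p (sr i) = -1 := rfl

/-- The action of `DihedralGroup p` on the vertices of the `p`-gon. -/
def vertexPerm : DihedralGroup p →* Equiv.Perm (ZMod p) :=
  MonoidHom.toHomPerm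
    { toFun := fun | r i => fun s => s + i | sr i => fun s => -(s + i)
      map_one' := funext fun s => add_zero s
      map_mul' := by
        rintro (i | i) (j | j) <;> funext s
        · change s + (i + j) = s + j + i
          ring
        · change -(s + (j - i)) = -(s + j) + i
          ring
        · change -(s + (i + j)) = -(s + j + i)
          ring
        · change s + (j - i) = -(-(s + j) + i)
          ring }

@[simp] theorem vertexPerm_r (i s : ZMod p) : vertexPerm p (r i) s = s + i := rfl

@[simp] theorem vertexPerm_sr (i s : ZMod p) : vertexPerm p (sr i) s = -(s + i) := rfl

variable {p}

theorem sum_eq [NeZero p] {M : Type*} [AddCommMonoid M] (f : DihedralGroup p → M) :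
    ∑ g, f g = ∑ i, f (r i) + ∑ i, f (sr i) := by
  let e : ZMod p ⊕ ZMod p ≃ DihedralGroup p :=
    { toFun := Sum.elim r sr
      invFun := fun | r i => .inl i | sr i => .inr i
      left_inv := by rintro (i | i) <;> rfl
      right_inv := by rintro (i | i) <;> rfl }
  rw [← e.sum_comp, Fintype.sum_sum_type]
  rfl

theorem card_filter_sign [NeZero p] (u : ℤˣ) :
    (Finset.univ.filter fun g : DihedralGroup p => Rep.signPerm (sign p) g 1 = u).card = p := by
  rw [Finset.card_filter, sum_eq]
  rcases Int.units_eq_one_or u with rfl | rfl <;> simp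

theorem card_filter_vertexPerm [NeZero p] (s : ZMod p) :
    (Finset.univ.filter fun g : DihedralGroup p => vertexPerm p g 0 = s).card = 2 := by
  rw [Finset.card_filter, sum_eq]
  simp [neg_eq_iff_eq_neg]

variable (χ : DihedralGroup p →* ℤˣ) (M : Type) [AddCommGroup M]

open Rep

theorem inv_vertexPerm_add_one_sub (g : DihedralGroup p) (φ : ZMod p → M) (s : ZMod p) :
    φ ((vertexPerm p g)⁻¹ (s + 1)) - φ ((vertexPerm p g)⁻¹ (s - 1)) = (sign p g : ℤ) •
      (φ ((vertexPerm p g)⁻¹ s + 1) - φ ((vertexPerm p g)⁻¹ s - 1)) := by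
  rw [← map_inv]
  rcases g with i | i
  · simp [add_sub_right_comm, add_right_comm]
  · simp
    congr 2 <;> ring

/-- The sum of the values of a function on the vertices of the `p`-gon. -/
noncomputable def sumHom [NeZero p] : twistedFun (vertexPerm p) χ M ⟶ twist χ M :=
  Rep.ofHom
    { toFun φ := ∑ s, φ s
      map_add' φ ψ := Finset.sum_add_distrib
      map_smul' r φ := (Finset.smul_sum (r := r) (f := φ) (s := Finset.univ)).symm
      isIntertwining' g := by
        refine LinearMap.ext fun φ => ?_
        change ∑ s, (twistedFun (vertexPerm p) χ M).ρ g φ s = (χ g : ℤ) • ∑ s, φ s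
        refine (Finset.sum_congr rfl fun s _ => twistedFun_ρ_apply _ _ g φ s).trans ?_
        rw [← Finset.smul_sum, Equiv.sum_comp (vertexPerm p g)⁻¹ φ] }

theorem sumHom_apply [NeZero p] (φ : ZMod p → M) : (sumHom χ M).hom φ = ∑ s, φ s := rfl

theorem ker_sumHom_le_comap [NeZero p] (g : DihedralGroup p) :
    LinearMap.ker (sumHom χ M).hom.toLinearMap ≤
      (LinearMap.ker (sumHom χ M).hom.toLinearMap).comap ((twistedFun (vertexPerm p) χ M).ρ g) := by
  intro φ hφ
  have hφ' : (sumHom χ M).hom φ = 0 := hφ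
  change (sumHom χ M).hom _ = 0
  rw [Rep.hom_comm_apply, hφ', map_zero]

/-- The functions on the vertices of the `p`-gon with sum zero. -/
noncomputable abbrev sumZero [NeZero p] : Rep ℤ (DihedralGroup p) :=
  Rep.subrepresentation (twistedFun (vertexPerm p) χ M) _ (ker_sumHom_le_comap χ M)

/-- The difference of the values of a function at the two neighbours of each vertex. -/
noncomputable def stepHom [NeZero p] :
    twistedFun (vertexPerm p) χ M ⟶ sumZero (χ * sign p) M :=
  Rep.ofHom
    { toFun φ := ⟨fun s => φ (s + 1) - φ (s - 1), by
        change ∑ s, (φ (s + 1) - φ (s - 1)) = 0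
        rw [Finset.sum_sub_distrib]
        exact sub_eq_zero.2 ((Equiv.sum_comp (Equiv.addRight 1) φ).trans
          (Equiv.sum_comp (Equiv.subRight 1) φ).symm)⟩
      map_add' φ ψ := by
        refine Subtype.ext (funext fun s => ?_)
        exact add_sub_add_comm _ _ _ _
      map_smul' r φ := by
        refine Subtype.ext (funext fun s => ?_)
        exact (smul_sub r (φ (s + 1) : M) (φ (s - 1))).symm
      isIntertwining' g := by
        refine LinearMap.ext fun φ => Subtype.ext (funext fun s => ?_)
        change (twistedFun (vertexPerm p) χ M).ρ g φ (s + 1) -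
            (twistedFun (vertexPerm p) χ M).ρ g φ (s - 1) =
          (twistedFun (vertexPerm p) (χ * sign p) M).ρ g (fun s => φ (s + 1) - φ (s - 1)) s
        rw [twistedFun_ρ_apply, twistedFun_ρ_apply, twistedFun_ρ_apply, ← smul_sub,
          inv_vertexPerm_add_one_sub, ← mul_smul, MonoidHom.mul_apply, Units.val_mul] }

theorem shortExact_sum [NeZero p] :
    (CategoryTheory.ShortComplex.mk
      (Rep.subtype (twistedFun (vertexPerm p) χ M) _ (ker_sumHom_le_comap χ M)) (sumHom χ M)
      (by ext φ; exact φ.2)).ShortExact := by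
  refine groupCohomology.shortExact_of_exact _ _ Subtype.val_injective (fun m => ?_) ?_
  · refine ⟨Pi.single 0 m, ?_⟩
    rw [sumHom_apply]
    exact Fintype.sum_pi_single' 0 m
  · intro φ
    exact ⟨fun h => ⟨⟨φ, h⟩, rfl⟩, by rintro ⟨ψ, rfl⟩; exact ψ.2⟩

theorem shortExact_step [NeZero p] (hp : Odd p) :
    (CategoryTheory.ShortComplex.mk (constHom (vertexPerm p) χ M) (stepHom χ M)
      (by ext m; exact sub_self (m : M))).ShortExact := by
  refine groupCohomology.shortExact_of_exact _ _ (fun a b h => congrFun h 0) ?_ ?_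
  · rintro ⟨φ, hφ⟩
    replace hφ : ∑ s, φ s = 0 := hφ
    obtain ⟨ψ, hψ⟩ := ZMod.exists_sub_eq_of_sum_eq_zero_of_odd hp φ hφ
    exact ⟨ψ, Subtype.ext (funext hψ)⟩
  · intro φ
    constructor
    · intro h
      refine ⟨φ 0, funext fun s => (ZMod.eq_const_of_forall_sub_eq_zero hp φ (fun t => ?_) s).symm⟩
      exact congrFun (congrArg Subtype.val h) t
    · rintro ⟨m, rfl⟩
      exact Subtype.ext (funext fun _ => sub_self m)

variable {M}

section TwoInvertible

variable [NeZero p] (hp : Odd p) (hM : Function.Bijective fun m : M => 2 • m)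

include hp hM

theorem isZero_groupCohomology_twist_iff (n : ℕ) :
    IsZero (groupCohomology (twist χ M) (n + 3)) ↔
      IsZero (groupCohomology (twist (χ * sign p) M) (n + 1)) :=
  (groupCohomology.isZero_X₁_iff (shortExact_step χ M hp) (n + 1)
    (isZero_groupCohomology_twistedFun _ _ 0 2 card_filter_vertexPerm hM)).trans
  (groupCohomology.isZero_X₁_iff (shortExact_sum (χ * sign p) M) n
    (isZero_groupCohomology_twistedFun _ _ 0 2 card_filter_vertexPerm hM))

theorem isZero_groupCohomology_twist_add_four_mul_iff (n k : ℕ) :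
    IsZero (groupCohomology (twist χ M) (4 * k + (n + 1))) ↔
      IsZero (groupCohomology (twist χ M) (n + 1)) := by
  have hχ : χ * sign p * sign p = χ := by
    ext g
    simp [mul_assoc, Int.units_mul_self]
  induction k with
  | zero => simp
  | succ k ih =>
    refine Iff.trans ?_ ih
    rw [show 4 * (k + 1) + (n + 1) = 4 * k + n + 2 + 3 by ring, ← add_assoc (4 * k)]
    refine (isZero_groupCohomology_twist_iff χ hp hM _).trans ?_
    refine (isZero_groupCohomology_twist_iff (χ * sign p) hp hM (4 * k + n)).trans ?_
    rw [hχ]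

theorem isZero_groupCohomology_two :
    IsZero (groupCohomology (twist (1 : DihedralGroup p →* ℤˣ) M) 2) := by
  refine (groupCohomology.isZero_X₁_iff (shortExact_step (p := p) 1 M hp) 0
    (isZero_groupCohomology_twistedFun _ _ 0 2 card_filter_vertexPerm hM)).2 ?_
  have hepi := groupCohomology.epi_δ_of_isZero (shortExact_sum (1 * sign p) M) 0
    (isZero_groupCohomology_twistedFun _ _ 0 2 card_filter_vertexPerm hM 0)
  refine IsZero.of_epi (groupCohomology.δ (shortExact_sum (1 * sign p) M) 0 1 rfl) ?_
  refine IsZero.of_iso ?_ (groupCohomology.H0Iso (twist (1 * sign p) M))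
  refine (ModuleCat.isZero_iff_subsingleton).2 ⟨fun ⟨a, ha⟩ ⟨b, hb⟩ => Subtype.ext ?_⟩
  have key (m : M) (hm : (twist (1 * sign p) M).ρ (sr 0) m = m) : m = 0 := by
    refine hM.1 ?_
    rw [twist_ρ_apply] at hm
    simp at hm
    simp only [smul_zero, two_nsmul]
    nth_rewrite 1 [← hm]
    exact neg_add_cancel m
  exact (key a (ha _)).trans (key b (hb _)).symm

omit [NeZero p] hp in
theorem isZero_groupCohomology_one :
    IsZero (groupCohomology (twist (1 : DihedralGroup p →* ℤˣ) M) 1) := by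
  rw [twist_one]
  refine IsZero.of_iso ?_ (groupCohomology.H1IsoOfIsTrivial (Rep.trivial ℤ (DihedralGroup p) M))
  have hsr (f : Additive (DihedralGroup p) →+ M) (i : ZMod p) : f (.ofMul (sr i)) = 0 := by
    refine hM.1 ?_
    simp only [smul_zero]
    rw [← map_nsmul, ← ofMul_pow, pow_two, sr_mul_self, ofMul_one, map_zero]
  have hf (f : Additive (DihedralGroup p) →+ M) : f = 0 := by
    refine AddMonoidHom.ext fun g => ?_
    rcases g with i | i
    · have : (r i : DihedralGroup p) = sr 0 * sr i := by simp
      refine (congrArg f (congrArg Additive.ofMul this)).trans ?_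
      rw [ofMul_mul, map_add, hsr, hsr, add_zero]
      rfl
    · exact hsr f i
  exact (ModuleCat.isZero_iff_subsingleton).2 ⟨fun a b => (hf a).trans (hf b).symm⟩

end TwoInvertible

section OddInvertible

variable [NeZero p] (hM : Function.Bijective fun m : M => p • m)

include hM

theorem nonempty_iso_twist_mul_sign (n : ℕ) :
    Nonempty (groupCohomology (twist (χ * sign p) M) (n + 1) ≅
      groupCohomology (twist χ M) (n + 2)) :=
  have h := isZero_groupCohomology_twistedFun (signPerm (sign p)) χ 1 p card_filter_sign hM
  have := groupCohomology.isIso_δ_of_isZero (shortExact_signDiff χ (sign p)) (n + 1) (h n)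
    (h (n + 1))
  ⟨asIso (groupCohomology.δ (shortExact_signDiff χ (sign p)) (n + 1) (n + 2) rfl)⟩

theorem nonempty_iso_twist_sign (k : ℕ) :
    Nonempty (groupCohomology (twist (sign p) M) (2 * k + 1) ≅
      groupCohomology (twist (sign p) M) 1) := by
  induction k with
  | zero => exact ⟨Iso.refl _⟩
  | succ k ih =>
    obtain ⟨e⟩ := ih
    obtain ⟨e₁⟩ := nonempty_iso_twist_mul_sign (sign p) hM (2 * k + 1)
    obtain ⟨e₂⟩ := nonempty_iso_twist_mul_sign (sign p * sign p) hM (2 * k)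
    rw [show sign p * sign p * sign p = sign p by ext g; simp [Int.units_mul_self]] at e₂
    exact ⟨e₁.symm ≪≫ e₂.symm ≪≫ e⟩

theorem nonempty_iso_trivial (k : ℕ) :
    Nonempty (groupCohomology (Rep.trivial ℤ (DihedralGroup p) M) (2 * k + 2) ≅
      groupCohomology (twist (sign p) M) 1) := by
  obtain ⟨e⟩ := nonempty_iso_twist_sign hM k
  obtain ⟨e'⟩ := nonempty_iso_twist_mul_sign (1 : DihedralGroup p →* ℤˣ) hM (2 * k)
  rw [one_mul, twist_one] at e'
  exact ⟨e'.symm ≪≫ e⟩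

/-- The first cohomology of the sign representation on `M` is `M / 2 M`. -/
theorem nonempty_addEquiv_one {N : Type} [AddCommGroup N] (π : M →+ N)
    (hπ : Function.Surjective π) (hker : ∀ m, π m = 0 ↔ ∃ x, 2 • x = m) :
    Nonempty (groupCohomology (twist (sign p) M) 1 ≃+ N) := by
  have hX := shortExact_signDiff (M := M) (sign p) (sign p)
  let X₃ := twist (sign p * sign p) M
  have hinv (m : M) : m ∈ X₃.ρ.invariants := fun g => by
    refine (twist_ρ_apply _ _ _).trans ?_
    simp [Int.units_mul_self]
  have hepi : Epi (groupCohomology.δ hX 0 1 rfl) := groupCohomology.epi_δ_of_isZero hX 0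
    (isZero_groupCohomology_twistedFun (signPerm (sign p)) (sign p) 1 p card_filter_sign hM 0)
  let d : groupCohomology X₃ 0 →+ groupCohomology (twist (sign p) M) 1 :=
    (groupCohomology.δ hX 0 1 rfl).hom.toAddMonoidHom
  let q : groupCohomology X₃ 0 →+ N :=
    π.comp ((Submodule.subtype _).comp (groupCohomology.H0Iso X₃).hom.hom).toAddMonoidHom
  have hd : Function.Surjective d := (ModuleCat.epi_iff_surjective _).1 hepi
  have hq : Function.Surjective q := fun n => by
    obtain ⟨m, rfl⟩ := hπ n
    refine ⟨(groupCohomology.H0Iso X₃).inv ⟨m, hinv m⟩, ?_⟩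
    change π ((groupCohomology.H0Iso X₃).hom ((groupCohomology.H0Iso X₃).inv ⟨m, hinv m⟩)).1 = π m
    rw [Iso.inv_hom_id_apply]
  have hdq : d.ker = q.ker := by
    ext x
    refine (groupCohomology.δ_zero_apply_eq_zero_iff hX x).trans (Iff.trans ?_ (hker _).symm)
    constructor
    · rintro ⟨φ, hφ, hx⟩
      refine ⟨φ 1, Eq.trans ?_ hx⟩
      have h := congrFun (hφ (sr 0)) 1
      rw [twistedFun_ρ_apply, ← map_inv, signPerm_apply] at h
      change 2 • φ 1 = φ 1 - φ (-1)
      simp only [sign_sr, inv_sr, mul_one, Units.val_neg, Units.val_one, neg_smul, one_smul] at h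
      rw [two_nsmul, sub_eq_add_neg, h]
    · rintro ⟨m, hm⟩
      refine ⟨fun u => (u : ℤ) • m, fun g => funext fun u => ?_, Eq.trans ?_ hm⟩
      · rw [twistedFun_ρ_apply, ← map_inv, signPerm_apply, ← mul_smul, ← Units.val_mul, map_inv,
          mul_inv_cancel_left]
      · change ((1 : ℤˣ) : ℤ) • m - ((-1 : ℤˣ) : ℤ) • m = 2 • m
        simp [two_nsmul]
  exact ⟨(QuotientAddGroup.quotientKerEquivOfSurjective d hd).symm.trans
    ((QuotientAddGroup.quotientAddEquivOfEq hdq).trans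
      (QuotientAddGroup.quotientKerEquivOfSurjective q hq))⟩

end OddInvertible

end DihedralGroup

namespace PadicInt

theorem bijective_nsmul {p : ℕ} (hp : Odd p) : Function.Bijective fun x : ℤ_[2] => p • x := by
  have hu : IsUnit (p : ℤ_[2]) := by
    rw [PadicInt.isUnit_iff, PadicInt.norm_natCast_eq_one_iff]
    exact (Nat.coprime_two_left).2 hp
  simp only [nsmul_eq_mul]
  exact IsUnit.isUnit_iff_mulLeft_bijective.1 hu

theorem toZMod_eq_zero_iff (x : ℤ_[2]) : toZMod x = 0 ↔ ∃ y, 2 • y = x := by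
  rw [← RingHom.mem_ker, ker_toZMod, maximalIdeal_eq_span_p, Ideal.mem_span_singleton]
  simp [Dvd.dvd, nsmul_eq_mul, eq_comm]

theorem toZMod_surjective : Function.Surjective (toZMod : ℤ_[2] →+* ZMod 2) :=
  ZMod.ringHom_surjective _

theorem bijective_two_nsmul_quotient :
    Function.Bijective fun x : ℤ_[2] ⧸ (Int.castAddHom ℤ_[2]).range => 2 • x := by
  constructor
  · refine (injective_iff_map_eq_zero
      (nsmulAddMonoidHom (α := ℤ_[2] ⧸ (Int.castAddHom ℤ_[2]).range) 2)).2 fun x => ?_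
    induction x using QuotientAddGroup.induction_on with | H x =>
    intro hx
    obtain ⟨m, hm⟩ := (QuotientAddGroup.eq_zero_iff (2 • x)).1 hx
    replace hm : (m : ℤ_[2]) = 2 • x := hm
    have hm0 := (toZMod_eq_zero_iff _).2 ⟨x, hm.symm⟩
    rw [map_intCast, ZMod.intCast_zmod_eq_zero_iff_dvd] at hm0
    obtain ⟨l, rfl⟩ := hm0
    refine (QuotientAddGroup.eq_zero_iff x).2 ⟨l, ?_⟩
    refine mul_left_cancel₀ (two_ne_zero (α := ℤ_[2])) ?_
    simpa [nsmul_eq_mul] using hm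
  · intro x
    induction x using QuotientAddGroup.induction_on with | H x =>
    obtain ⟨y, hy⟩ := (toZMod_eq_zero_iff (x - ((toZMod x).val : ℕ))).1 (by
      rw [map_sub, map_natCast, ZMod.natCast_zmod_val, sub_self])
    refine ⟨y, ?_⟩
    refine (QuotientAddGroup.eq (s := (Int.castAddHom ℤ_[2]).range) (a := 2 • y)).2
      ⟨(toZMod x).val, ?_⟩
    change (((toZMod x).val : ℤ) : ℤ_[2]) = -(2 • y) + x
    rw [hy, Int.cast_natCast]
    ring

end PadicInt

namespace Rep

variable (G : Type) [Group G]

/-- The morphism of trivial representations induced by a homomorphism of abelian groups. -/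
noncomputable def trivialMap {A B : Type} [AddCommGroup A] [AddCommGroup B] (f : A →+ B) :
    Rep.trivial ℤ G A ⟶ Rep.trivial ℤ G B :=
  Rep.ofHom
    { f.toIntLinearMap with
      isIntertwining' _ := rfl }

theorem shortExact_trivial_quotient {A B : Type} [AddCommGroup A] [AddCommGroup B] (f : A →+ B)
    (hf : Function.Injective f) :
    (ShortComplex.mk (trivialMap G f) (trivialMap G (QuotientAddGroup.mk' f.range))
      (by ext a; exact (QuotientAddGroup.eq_zero_iff (f a)).2 ⟨a, rfl⟩)).ShortExact :=
  groupCohomology.shortExact_of_exact _ _ hf (QuotientAddGroup.mk'_surjective _)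
    fun b => QuotientAddGroup.eq_zero_iff b

end Rep

namespace groupCohomology

universe u

variable {k G : Type u} [CommRing k] [Group G]

theorem nonempty_iso_of_isZero_X₃ {X : ShortComplex (Rep.{u} k G)} (hX : X.ShortExact) (n : ℕ)
    (h : IsZero (groupCohomology X.X₃ n)) (h' : IsZero (groupCohomology X.X₃ (n + 1))) :
    Nonempty (groupCohomology X.X₁ (n + 1) ≅ groupCohomology X.X₂ (n + 1)) := by
  have : Mono (map (MonoidHom.id G) X.f (n + 1)) :=
    (mapShortComplex₁_exact hX (i := n) (j := n + 1) rfl).mono_g (h.eq_of_src _ _)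
  have : Epi (map (MonoidHom.id G) X.f (n + 1)) :=
    (mapShortComplex₂_exact hX (n + 1)).epi_f (h'.eq_of_tgt _ _)
  have := isIso_of_mono_of_epi (map (MonoidHom.id G) X.f (n + 1))
  exact ⟨asIso (map (MonoidHom.id G) X.f (n + 1))⟩

end groupCohomology

/-- For `p` an odd prime and `G = D_{2p}` the dihedral group of order `2p`, the group
cohomology `H^n(G; ℤ)` with trivial coefficients is isomorphic to `ℤ/2` whenever
`n ≡ 2 (mod 4)`. -/
theorem dihedral_trivial_cohomology_two_mod_four (p : ℕ) (hp : p.Prime) (hodd : Odd p)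
    (n : ℕ) (hn : n % 4 = 2) :
    Nonempty (groupCohomology (Rep.trivial ℤ (DihedralGroup p) ℤ) n ≃+ ZMod 2) := by
  have : NeZero p := ⟨hp.ne_zero⟩
  obtain ⟨k, rfl⟩ : ∃ k, n = 4 * k + 1 + 1 := ⟨n / 4, by omega⟩
  have hB := PadicInt.bijective_two_nsmul_quotient
  have hA := PadicInt.bijective_nsmul hodd
  have h₁ := (DihedralGroup.isZero_groupCohomology_twist_add_four_mul_iff 1 hodd hB 0 k).2
    (DihedralGroup.isZero_groupCohomology_one hB)
  have h₂ := (DihedralGroup.isZero_groupCohomology_twist_add_four_mul_iff 1 hodd hB 1 k).2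
    (DihedralGroup.isZero_groupCohomology_two hodd hB)
  rw [Rep.twist_one] at h₁ h₂
  obtain ⟨e⟩ := groupCohomology.nonempty_iso_of_isZero_X₃ (Rep.shortExact_trivial_quotient
    (DihedralGroup p) (Int.castAddHom ℤ_[2]) Int.cast_injective) (4 * k + 1) h₁ h₂
  obtain ⟨e'⟩ := DihedralGroup.nonempty_iso_trivial hA (2 * k)
  rw [show 2 * (2 * k) + 2 = 4 * k + 1 + 1 by ring] at e'
  obtain ⟨e''⟩ := DihedralGroup.nonempty_addEquiv_one hA PadicInt.toZMod.toAddMonoidHom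
    PadicInt.toZMod_surjective PadicInt.toZMod_eq_zero_iff
  exact ⟨(e ≪≫ e').toLinearEquiv.toAddEquiv.trans e''⟩
end
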